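/- Let L : ℝ → ℝ be a nonnegative, measurable, Lebesgue-integrable function with ∫ L(θ) dθ > 0, and for σ > 0 define m(σ) = ∫ (1/(σ·√(2π)))·exp(−θ²/(2σ²))·L(θ) dθ. Then for every fixed k > 0, the ratio m(σ)/m(k·σ) → k as σ → ∞. In particular, replacing a normal(0, σ²) prior by a normal(0, (100σ)²) prior multiplies the Bayes factor in favor of a competing model by a factor approaching 100. -/

import Mathlib

open MeasureTheory Real Filter

theorem tendsto_integral_exp_neg_sq_div_mul {f : ℝ → ℝ} (hf : Integrable f) :
    Tendsto (fun σ : ℝ => ∫ θ : ℝ, Real.exp (-θ ^ 2 / (2 * σ ^ 2)) * f θ) atTop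
      (nhds (∫ θ : ℝ, f θ)) := by
  refine tendsto_integral_filter_of_dominated_convergence (fun θ => ‖f θ‖) ?_ ?_ hf.norm ?_
  · exact Eventually.of_forall fun σ =>
      (by fun_prop : Measurable fun θ : ℝ => Real.exp (-θ ^ 2 / (2 * σ ^ 2))).aestronglyMeasurable.mul
        hf.aestronglyMeasurable
  · refine Eventually.of_forall fun σ => Eventually.of_forall fun θ => ?_
    rw [norm_mul, Real.norm_of_nonneg (Real.exp_pos _).le]
    refine mul_le_of_le_one_left (norm_nonneg _) (Real.exp_le_one_iff.mpr ?_)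
    exact div_nonpos_of_nonpos_of_nonneg (neg_nonpos.mpr (sq_nonneg θ)) (by positivity)
  · refine Eventually.of_forall fun θ => ?_
    have hden : Tendsto (fun σ : ℝ => 2 * σ ^ 2) atTop atTop :=
      (tendsto_pow_atTop two_ne_zero).const_mul_atTop two_pos
    simpa using ((Real.continuous_exp.tendsto 0).comp
      (hden.const_div_atTop (-θ ^ 2))).mul_const (f θ)

/-- widening a normal(0, σ²) prior to normal(0, (kσ)²) rescales the marginal
likelihood by a factor approaching 1/k, i.e., m(σ)/m(kσ) → k as σ → ∞. -/
theorem bayes_factor_prior_scale_ratio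
    (L : ℝ → ℝ) (hL : ∀ θ, 0 ≤ L θ) (hmeas : Measurable L) (hint : Integrable L)
    (hpos : 0 < ∫ θ : ℝ, L θ)
    (m : ℝ → ℝ)
    (hm : ∀ σ : ℝ, m σ = ∫ θ : ℝ,
      (1 / (σ * Real.sqrt (2 * Real.pi))) * Real.exp (-θ ^ 2 / (2 * σ ^ 2)) * L θ)
    (k : ℝ) (hk : 0 < k) :
    Tendsto (fun σ : ℝ => m σ / m (k * σ)) atTop (nhds k) := by
  have hg := tendsto_integral_exp_neg_sq_div_mul hint
  have hgk := hg.comp (tendsto_id.const_mul_atTop hk)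
  have hlim := (hg.div hgk hpos.ne').const_mul k
  rw [div_self hpos.ne', mul_one] at hlim
  refine hlim.congr' ?_
  filter_upwards [eventually_gt_atTop 0] with σ hσ
  have hs : 0 < Real.sqrt (2 * Real.pi) := by positivity
  simp only [hm, mul_assoc, integral_const_mul, Pi.div_apply, Function.comp_apply, id]
  rw [mul_div_mul_comm]
  congr 1
  field_simp
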